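/- Let Γ be an ω-categorical model-complete core that has a symmetric polymorphism modulo endomorphisms, i.e., there exist a binary polymorphism f of Γ and endomorphisms e₁, e₂ of Γ with e₁(f(x,y)) = e₂(f(y,x)) for all x, y in the domain of Γ. Then for any elements a₁, a₂, …, a_n of Γ there is no clone homomorphism from Pol(Γ, a₁, a₂, …, a_n) to 𝟏. -/

import Mathlib

/-! ### Relational structures and primitive positive formulas -/

/-- A relational structure with relation symbols `σ`, arities `ar`, and domain `D`. -/
structure RelStruct (σ : Type) (ar : σ → ℕ) (D : Type) where
  rel : (s : σ) → (Fin (ar s) → D) → Prop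

/-- Primitive positive formulas over the relational signature `(σ, ar)`, with `n` free
variables (built from atomic formulas using only conjunction and existential
quantification). -/
inductive PPFormula (σ : Type) (ar : σ → ℕ) : ℕ → Type
  | eq {n : ℕ} (i j : Fin n) : PPFormula σ ar n
  | rel {n : ℕ} (s : σ) (v : Fin (ar s) → Fin n) : PPFormula σ ar n
  | and {n : ℕ} (φ ψ : PPFormula σ ar n) : PPFormula σ ar n
  | ex {n : ℕ} (φ : PPFormula σ ar (n + 1)) : PPFormula σ ar n

/-- Satisfaction of a primitive positive formula in a structure, under an assignment. -/
def PPFormula.Realize {σ : Type} {ar : σ → ℕ} {D : Type} (Γ : RelStruct σ ar D) :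
    {n : ℕ} → PPFormula σ ar n → (Fin n → D) → Prop
  | _, .eq i j, t => t i = t j
  | _, .rel s v, t => Γ.rel s (fun m => t (v m))
  | _, .and φ ψ, t => φ.Realize Γ t ∧ ψ.Realize Γ t
  | _, .ex φ, t => ∃ d : D, φ.Realize Γ (Fin.snoc t d)

/-- A relation is primitive positive definable in `Γ` if it is the set of solutions of a
primitive positive formula over the signature of `Γ`. -/
def PPDefinable {σ : Type} {ar : σ → ℕ} {D : Type} (Γ : RelStruct σ ar D) {n : ℕ}
    (R : (Fin n → D) → Prop) : Prop :=
  ∃ φ : PPFormula σ ar n, ∀ t, R t ↔ φ.Realize Γ t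

/-- The expansion of a structure by the constants `a 0, …, a (n-1)`, realised as new
singleton unary relations. -/
def RelStruct.withConstants {σ : Type} {ar : σ → ℕ} {D : Type} (Γ : RelStruct σ ar D)
    {n : ℕ} (a : Fin n → D) : RelStruct (σ ⊕ Fin n) (Sum.elim ar fun _ => 1) D where
  rel s := match s with
    | .inl s => fun t => Γ.rel s t
    | .inr i => fun t : Fin 1 → D => t 0 = a i

/-- Flattening a `k`-tuple of `d`-tuples into a `(k*d)`-tuple. -/
def flattenTuple {D : Type} {k d : ℕ} (ts : Fin k → Fin d → D) : Fin (k * d) → D :=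
  fun j => ts (finProdFinEquiv.symm j).1 (finProdFinEquiv.symm j).2

/-- A primitive positive interpretation of the structure `Δ` in the structure `Γ`:
a dimension `dim`, a primitive positive domain formula, primitive positive defining
formulas for equality and for each atomic formula, and a coordinate map, surjective
onto `Δ`, from the `dim`-tuples satisfying the domain formula. -/
structure PPInterpretation {σ₁ : Type} {ar₁ : σ₁ → ℕ} {D : Type} (Γ : RelStruct σ₁ ar₁ D)
    {σ₂ : Type} {ar₂ : σ₂ → ℕ} {E : Type} (Δ : RelStruct σ₂ ar₂ E) : Type where
  dim : ℕ
  domFml : PPFormula σ₁ ar₁ dim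
  eqFml : PPFormula σ₁ ar₁ (2 * dim)
  relFml : (s : σ₂) → PPFormula σ₁ ar₁ (ar₂ s * dim)
  coord : (Fin dim → D) → E
  coord_surj : ∀ e : E, ∃ t, domFml.Realize Γ t ∧ coord t = e
  eq_iff : ∀ t₁ t₂ : Fin dim → D, domFml.Realize Γ t₁ → domFml.Realize Γ t₂ →
    (coord t₁ = coord t₂ ↔ eqFml.Realize Γ (flattenTuple ![t₁, t₂]))
  rel_iff : ∀ (s : σ₂) (ts : Fin (ar₂ s) → Fin dim → D),
    (∀ i, domFml.Realize Γ (ts i)) →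
    (Δ.rel s (fun i => coord (ts i)) ↔ (relFml s).Realize Γ (flattenTuple ts))

/-- The Boolean structure `({0,1}; NAE)`, where `NAE = {0,1}³ \ {(0,0,0),(1,1,1)}`. -/
def NAEStruct : RelStruct Unit (fun _ => 3) Bool where
  rel := fun _ t => (∃ i, t i = true) ∧ (∃ i, t i = false)
/-! ### First-order formulas, ω-categoricity, model-complete cores -/

/-- First-order formulas over the relational signature `(σ, ar)` with `n` free variables. -/
inductive FOFormula (σ : Type) (ar : σ → ℕ) : ℕ → Type
  | eq {n : ℕ} (i j : Fin n) : FOFormula σ ar n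
  | rel {n : ℕ} (s : σ) (v : Fin (ar s) → Fin n) : FOFormula σ ar n
  | not {n : ℕ} (φ : FOFormula σ ar n) : FOFormula σ ar n
  | and {n : ℕ} (φ ψ : FOFormula σ ar n) : FOFormula σ ar n
  | ex {n : ℕ} (φ : FOFormula σ ar (n + 1)) : FOFormula σ ar n

/-- Satisfaction of a first-order formula in a structure, under an assignment. -/
def FOFormula.Realize {σ : Type} {ar : σ → ℕ} {D : Type} (Γ : RelStruct σ ar D) :
    {n : ℕ} → FOFormula σ ar n → (Fin n → D) → Prop
  | _, .eq i j, t => t i = t j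
  | _, .rel s v, t => Γ.rel s (fun m => t (v m))
  | _, .not φ, t => ¬ φ.Realize Γ t
  | _, .and φ ψ, t => φ.Realize Γ t ∧ ψ.Realize Γ t
  | _, .ex φ, t => ∃ d : D, φ.Realize Γ (Fin.snoc t d)

/-- A relation is first-order definable in `Γ` if it is the set of solutions of a
first-order formula over the signature of `Γ`. -/
def FODefinable {σ : Type} {ar : σ → ℕ} {D : Type} (Γ : RelStruct σ ar D) {n : ℕ}
    (R : (Fin n → D) → Prop) : Prop :=
  ∃ φ : FOFormula σ ar n, ∀ t, R t ↔ φ.Realize Γ t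

/-- Isomorphism of relational structures over the same signature. -/
def RelStruct.Isomorphic {σ : Type} {ar : σ → ℕ} {D E : Type}
    (Γ : RelStruct σ ar D) (Δ : RelStruct σ ar E) : Prop :=
  ∃ g : D ≃ E, ∀ (s : σ) (t : Fin (ar s) → D), Γ.rel s t ↔ Δ.rel s (fun i => g (t i))

/-- A countable structure is ω-categorical if all countable models of its first-order
theory are isomorphic (to it). -/
def IsOmegaCategorical {σ : Type} {ar : σ → ℕ} {D : Type} (Γ : RelStruct σ ar D) : Prop :=
  Countable D ∧ ∀ (E : Type) (Δ : RelStruct σ ar E), Countable E →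
    (∀ φ : FOFormula σ ar 0, φ.Realize Γ Fin.elim0 → φ.Realize Δ Fin.elim0) →
    Γ.Isomorphic Δ

/-- A self-map of the domain of `Γ` is an elementary self-embedding if it preserves the
truth of all first-order formulas. -/
def IsElementarySelfEmbedding {σ : Type} {ar : σ → ℕ} {D : Type} (Γ : RelStruct σ ar D)
    (e : D → D) : Prop :=
  ∀ {n : ℕ} (φ : FOFormula σ ar n) (t : Fin n → D),
    φ.Realize Γ t ↔ φ.Realize Γ (fun i => e (t i))

/-- A homomorphism between relational structures over the same signature. -/
def IsHom {σ : Type} {ar : σ → ℕ} {D E : Type} (Γ : RelStruct σ ar D) (Δ : RelStruct σ ar E)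
    (h : D → E) : Prop :=
  ∀ (s : σ) (t : Fin (ar s) → D), Γ.rel s t → Δ.rel s (fun i => h (t i))

/-- Two structures are homomorphically equivalent if there are homomorphisms in both
directions. -/
def HomEquiv {σ : Type} {ar : σ → ℕ} {D E : Type} (Γ : RelStruct σ ar D)
    (Δ : RelStruct σ ar E) : Prop :=
  (∃ h, IsHom Γ Δ h) ∧ (∃ h, IsHom Δ Γ h)

/-- A structure is a model-complete core if all its endomorphisms are elementary
self-embeddings. -/
def IsModelCompleteCore {σ : Type} {ar : σ → ℕ} {D : Type} (Γ : RelStruct σ ar D) : Prop :=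
  ∀ e : D → D, IsHom Γ Γ e → IsElementarySelfEmbedding Γ e
/-! ### Polymorphisms and endomorphisms -/

/-- A `k`-ary operation `f` preserves an `m`-ary relation `R` if applying `f`
componentwise to `k` tuples of `R` yields a tuple of `R`. -/
def PreservesRel {D : Type} {k m : ℕ} (f : (Fin k → D) → D) (R : (Fin m → D) → Prop) : Prop :=
  ∀ ts : Fin k → Fin m → D, (∀ i, R (ts i)) → R (fun j => f (fun i => ts i j))

/-- A polymorphism of `Γ` is a finitary operation on the domain preserving all
relations of `Γ`. -/
def IsPolymorphism {σ : Type} {ar : σ → ℕ} {D : Type} (Γ : RelStruct σ ar D) {k : ℕ}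
    (f : (Fin k → D) → D) : Prop :=
  ∀ s, PreservesRel f (Γ.rel s)

/-- A binary operation as an operation on `Fin 2`-tuples. -/
def binOp {D : Type} (f : D → D → D) : (Fin 2 → D) → D := fun t => f (t 0) (t 1)

/-- An endomorphism of `Γ` (a unary polymorphism). -/
def IsEndomorphism {σ : Type} {ar : σ → ℕ} {D : Type} (Γ : RelStruct σ ar D)
    (e : D → D) : Prop :=
  ∀ (s : σ) (t : Fin (ar s) → D), Γ.rel s t → Γ.rel s (fun i => e (t i))

/-- `Γ` has a symmetric polymorphism modulo endomorphisms: a binary polymorphism `f`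
and endomorphisms `e₁, e₂` with `e₁(f(x,y)) = e₂(f(y,x))` for all `x, y`. -/
def HasSymmetricPolymorphismModEndos {σ : Type} {ar : σ → ℕ} {D : Type}
    (Γ : RelStruct σ ar D) : Prop :=
  ∃ (f : D → D → D) (e₁ e₂ : D → D),
    IsPolymorphism Γ (binOp f) ∧ IsEndomorphism Γ e₁ ∧ IsEndomorphism Γ e₂ ∧
    ∀ x y, e₁ (f x y) = e₂ (f y x)
/-! ### Function clones and clone homomorphisms -/

/-- A function clone on `D`: a set of finitary operations containing all projections and
closed under composition. -/
structure Clone (D : Type) where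
  ops : ∀ n : ℕ, Set ((Fin n → D) → D)
  proj_mem : ∀ (n : ℕ) (i : Fin n), (fun t => t i) ∈ ops n
  comp_mem : ∀ {n m : ℕ} (f : (Fin n → D) → D) (g : Fin n → (Fin m → D) → D),
    f ∈ ops n → (∀ i, g i ∈ ops m) → (fun t => f (fun i => g i t)) ∈ ops m

/-- The polymorphism clone `Pol(Γ)` of a relational structure `Γ`. -/
def polClone {σ : Type} {ar : σ → ℕ} {D : Type} (Γ : RelStruct σ ar D) : Clone D where
  ops n := {f | IsPolymorphism Γ f}
  proj_mem n i := fun s ts h => h i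
  comp_mem := by
    intro n m f g hf hg s ts h
    exact hf s (fun i j => g i (fun l => ts l j)) (fun i => hg i s ts h)

/-- The clone of all projections on a set. -/
def projClone (B : Type) : Clone B where
  ops n := {f | ∃ i : Fin n, f = fun t => t i}
  proj_mem n i := ⟨i, rfl⟩
  comp_mem := by
    rintro n m f g ⟨i, rfl⟩ hg
    obtain ⟨j, hj⟩ := hg i
    exact ⟨j, by funext t; exact congrFun hj t⟩

/-- A clone homomorphism: an arity-preserving map sending projections to the
corresponding projections and commuting with composition. -/
structure CloneHom {D E : Type} (𝒞 : Clone D) (𝒟 : Clone E) where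
  map : ∀ {n : ℕ}, {f : (Fin n → D) → D // f ∈ 𝒞.ops n} → {g : (Fin n → E) → E // g ∈ 𝒟.ops n}
  map_proj : ∀ {n : ℕ} (i : Fin n),
    (map ⟨fun t => t i, 𝒞.proj_mem n i⟩).1 = fun t => t i
  map_comp : ∀ {n m : ℕ} (f : {f : (Fin n → D) → D // f ∈ 𝒞.ops n})
    (g : Fin n → {g : (Fin m → D) → D // g ∈ 𝒞.ops m}),
    (map ⟨fun t => f.1 (fun i => (g i).1 t),
      𝒞.comp_mem f.1 (fun i => (g i).1) f.2 (fun i => (g i).2)⟩).1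
      = fun t => (map f).1 (fun i => (map (g i)).1 t)

/-- The topology of pointwise convergence on the `n`-ary operations on `D`
(with `D` discrete). -/
def opSpaceTopology (D : Type) (n : ℕ) : TopologicalSpace ((Fin n → D) → D) :=
  @Pi.topologicalSpace (Fin n → D) (fun _ => D) (fun _ => ⊥)

/-- A clone homomorphism is continuous if each of its arity components is continuous with
respect to the topology of pointwise convergence. -/
def CloneHom.IsContinuous {D E : Type} {𝒞 : Clone D} {𝒟 : Clone E}
    (ξ : CloneHom 𝒞 𝒟) : Prop :=
  ∀ n : ℕ, @Continuous _ _ ((opSpaceTopology D n).induced Subtype.val)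
    ((opSpaceTopology E n).induced Subtype.val)
    (fun f : {f : (Fin n → D) → D // f ∈ 𝒞.ops n} => ξ.map f)
namespace NoCloneHom

variable {σ : Type} {ar : σ → ℕ} {D : Type}

theorem endo_id (Γ : RelStruct σ ar D) : IsEndomorphism Γ id := fun _ _ h => h

theorem endo_comp {Γ : RelStruct σ ar D} {u v : D → D} (hu : IsEndomorphism Γ u)
    (hv : IsEndomorphism Γ v) : IsEndomorphism Γ (u ∘ v) :=
  fun s t h => hu s _ (hv s t h)

theorem endo_inj {Γ : RelStruct σ ar D} (hcore : IsModelCompleteCore Γ) {u : D → D}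
    (hu : IsEndomorphism Γ u) : Function.Injective u := by
  intro x y hxy
  have := (hcore u hu (FOFormula.eq (n := 2) 0 1) ![x, y]).2 (by
    simpa [FOFormula.Realize] using hxy)
  simpa [FOFormula.Realize] using this

/-- Limits of chains of endomorphisms. -/
theorem chain_limit (Γ : RelStruct σ ar D) (hcat : IsOmegaCategorical Γ)
    (hcore : IsModelCompleteCore Γ) (T : ℕ → ℕ → D → D)
    (hT : ∀ k j, IsEndomorphism Γ (T k j)) (hid : ∀ k, T k k = id)
    (htr : ∀ i j k, i ≤ j → j ≤ k → ∀ x, T k j (T j i x) = T k i x) :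
    ∃ ι : ℕ → D → D, (∀ k, IsEndomorphism Γ (ι k)) ∧
      (∀ j k, j ≤ k → ∀ x, ι k (T k j x) = ι j x) ∧
      (∀ {n : ℕ} (a : Fin n → D), ∃ k, ∃ c : Fin n → D, ∀ i, ι k (c i) = a i) := by
  obtain ⟨hD, hcat⟩ := hcat
  let S : Setoid (ℕ × D) :=
    { r := fun p q => ∃ k, p.1 ≤ k ∧ q.1 ≤ k ∧ T k p.1 p.2 = T k q.1 q.2
      iseqv := by
        refine ⟨fun p => ⟨p.1, le_rfl, le_rfl, rfl⟩, ?_, ?_⟩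
        · rintro p q ⟨k, h1, h2, h⟩
          exact ⟨k, h2, h1, h.symm⟩
        · rintro p q r ⟨k, h1, h2, h⟩ ⟨l, h3, h4, h'⟩
          refine ⟨max k l, by omega, by omega, ?_⟩
          rw [← htr p.1 k (max k l) h1 (by omega), h, htr q.1 k _ h2 (by omega),
            ← htr q.1 l _ h3 (by omega), h', htr r.1 l _ h4 (by omega)] }
  let E := Quotient S
  let ι : ℕ → D → E := fun k x => Quotient.mk S (k, x)
  have hι : ∀ j k, j ≤ k → ∀ x, ι k (T k j x) = ι j x := by
    intro j k hjk x
    refine Quotient.sound ⟨k, le_rfl, hjk, ?_⟩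
    simp only [hid, id]
  have hinj : ∀ k x y, ι k x = ι k y → x = y := by
    intro k x y h
    obtain ⟨l, _, _, h⟩ := Quotient.exact h
    exact endo_inj hcore (hT l k) h
  have hsurj1 : ∀ e : E, ∃ k x, ι k x = e := by
    intro e
    induction e using Quotient.inductionOn with
    | h p => exact ⟨p.1, p.2, rfl⟩
  have hsurj : ∀ {n : ℕ} (t : Fin n → E), ∃ k, ∃ c : Fin n → D, ∀ i, ι k (c i) = t i := by
    intro n t
    choose K X hX using fun i => hsurj1 (t i)
    obtain ⟨k, hk⟩ : ∃ k, ∀ i, K i ≤ k :=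
      ⟨Finset.univ.sup K, fun i => Finset.le_sup (Finset.mem_univ i)⟩
    exact ⟨k, fun i => T k (K i) (X i), fun i => by rw [hι _ _ (hk i), hX]⟩
  let Δ : RelStruct σ ar E :=
    ⟨fun s t => ∃ k, ∃ t' : Fin (ar s) → D, (∀ i, ι k (t' i) = t i) ∧ Γ.rel s t'⟩
  have hel : ∀ k j {n : ℕ} (φ : FOFormula σ ar n) (t : Fin n → D),
      φ.Realize Γ t ↔ φ.Realize Γ (fun i => T k j (t i)) :=
    fun k j n φ t => hcore _ (hT k j) φ t
  have hrel : ∀ k s (t : Fin (ar s) → D), Δ.rel s (fun i => ι k (t i)) ↔ Γ.rel s t := by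
    intro k s t
    constructor
    · rintro ⟨l, t', h1, h2⟩
      have e1 := hel (max k l) k (FOFormula.rel s id) t
      have e2 := hel (max k l) l (FOFormula.rel s id) t'
      simp only [FOFormula.Realize, id] at e1 e2
      rw [e1]
      rw [e2] at h2
      convert h2 using 2 with i
      apply hinj (max k l)
      rw [hι _ _ (by omega), hι _ _ (by omega), h1]
    · intro h
      exact ⟨k, t, fun _ => rfl, h⟩
  have hreal : ∀ {n : ℕ} (φ : FOFormula σ ar n) (k : ℕ) (t : Fin n → D),
      φ.Realize Δ (fun i => ι k (t i)) ↔ φ.Realize Γ t := by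
    intro n φ
    induction φ with
    | eq i j =>
      intro k t
      exact ⟨fun h => hinj k _ _ h, fun h => congrArg (ι k) h⟩
    | rel s v => intro k t; exact hrel k s (fun m => t (v m))
    | not φ ih => intro k t; simp only [FOFormula.Realize, ih]
    | and φ ψ ih1 ih2 => intro k t; simp only [FOFormula.Realize, ih1, ih2]
    | @ex n φ ih =>
      intro k t
      have key : ∀ l (t : Fin n → D) d, φ.Realize Δ (Fin.snoc (fun i => ι l (t i)) (ι l d)) ↔
          φ.Realize Γ (Fin.snoc t d) := by
        intro l t d
        rw [← ih l]
        have : (Fin.snoc (fun i => ι l (t i)) (ι l d) : Fin (n+1) → E)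
            = fun i => ι l ((Fin.snoc t d : Fin (n+1) → D) i) := by
          funext i
          refine Fin.lastCases ?_ (fun i => ?_) i <;> simp
        rw [this]
      constructor
      · rintro ⟨d, hd⟩
        obtain ⟨l, x, rfl⟩ := hsurj1 d
        have h1 : (fun i => ι k (t i)) = fun i => ι (max k l) (T (max k l) k (t i)) := by
          funext i; rw [hι _ _ (by omega)]
        rw [h1, ← hι l (max k l) (by omega), key] at hd
        exact (hel (max k l) k (FOFormula.ex φ) t).2 ⟨_, hd⟩
      · rintro ⟨d, hd⟩
        exact ⟨ι k d, (key k t d).2 hd⟩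
  have hE : Countable E := inferInstance
  obtain ⟨g, hg⟩ := hcat E Δ hE (by
    intro φ h
    have := (hreal φ 0 Fin.elim0).2 h
    convert this using 2)
  refine ⟨fun k x => g.symm (ι k x), ?_, ?_, ?_⟩
  · intro k s t h
    rw [hg]
    simpa [hrel] using h
  · intro j k hjk x
    simp only [hι j k hjk]
  · intro n a
    obtain ⟨k, c, h⟩ := hsurj (fun i => g (a i))
    exact ⟨k, c, fun i => by simp [h]⟩

open Classical in
/-- If possible, an endomorphism moving `c` to a place from which `a` is unreachable. -/
noncomputable def killer (Γ : RelStruct σ ar D) {n : ℕ} (a c : Fin n → D) : D → D :=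
  if h : ∃ e, IsEndomorphism Γ e ∧ ¬ ∃ β, IsEndomorphism Γ β ∧ ∀ i, β (e (c i)) = a i
  then h.choose else id

theorem killer_endo (Γ : RelStruct σ ar D) {n : ℕ} (a c : Fin n → D) :
    IsEndomorphism Γ (killer Γ a c) := by
  unfold killer
  split_ifs with h
  · exact h.choose_spec.1
  · exact endo_id Γ

theorem killer_spec (Γ : RelStruct σ ar D) {n : ℕ} (a c : Fin n → D)
    (h : ∃ β, IsEndomorphism Γ β ∧ ∀ i, β (killer Γ a c (c i)) = a i)
    (e : D → D) (he : IsEndomorphism Γ e) :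
    ∃ β, IsEndomorphism Γ β ∧ ∀ i, β (e (c i)) = a i := by
  by_contra hc
  have hex : ∃ e, IsEndomorphism Γ e ∧ ¬ ∃ β, IsEndomorphism Γ β ∧ ∀ i, β (e (c i)) = a i :=
    ⟨e, he, hc⟩
  rw [killer, dif_pos hex] at h
  exact hex.choose_spec.2 h

/-- The transport maps from stage `j` to stage `k`. -/
noncomputable def trans (Γ : RelStruct σ ar D) {n : ℕ} (a : Fin n → D)
    (en : ℕ → Fin n → D) : ℕ → ℕ → D → D
  | 0 => fun _ => id
  | k + 1 => fun j => if j ≤ k then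
      killer Γ a (fun i => trans Γ a en k k.unpair.1 (en k.unpair.2 i)) ∘ trans Γ a en k j
      else id

theorem return_endo (Γ : RelStruct σ ar D) (hcat : IsOmegaCategorical Γ)
    (hcore : IsModelCompleteCore Γ) {n : ℕ} (a : Fin n → D) (e : D → D)
    (he : IsEndomorphism Γ e) : ∃ β, IsEndomorphism Γ β ∧ ∀ i, β (e (a i)) = a i := by
  have hD : Countable D := hcat.1
  have : Nonempty (Fin n → D) := ⟨a⟩
  obtain ⟨en, hen⟩ := exists_surjective_nat (Fin n → D)
  let T := trans Γ a en
  have hs : ∀ k j, j ≤ k → T (k+1) j =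
      killer Γ a (fun i => T k k.unpair.1 (en k.unpair.2 i)) ∘ T k j := by
    intro k j h
    simp only [T]
    conv_lhs => rw [trans]
    simp [h]
  have hend : ∀ k j, IsEndomorphism Γ (T k j) := by
    intro k
    induction k with
    | zero => intro j; exact endo_id Γ
    | succ k ih =>
      intro j
      by_cases h : j ≤ k
      · rw [hs k j h]
        exact endo_comp (killer_endo _ _ _) (ih j)
      · have : T (k+1) j = id := by
          simp only [T]; rw [trans]; simp [h]
        rw [this]; exact endo_id Γ
  have hid : ∀ k, T k k = id := by
    intro k
    cases k with
    | zero => rfl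
    | succ k => simp only [T]; rw [trans]; simp
  have htr : ∀ i j k, i ≤ j → j ≤ k → ∀ x, T k j (T j i x) = T k i x := by
    intro i j k hij hjk
    induction k, hjk using Nat.le_induction with
    | base => intro x; rw [hid]; rfl
    | succ k hk ih =>
      intro x
      rw [hs k j hk, hs k i (by omega)]
      simp only [Function.comp, ih]
  obtain ⟨ι, h1, h2, h3⟩ := chain_limit Γ hcat hcore T hend hid htr
  obtain ⟨j, c, hc⟩ := h3 a
  obtain ⟨m, rfl⟩ := hen c
  have hk := Nat.unpair_pair j m
  have hjk : j ≤ Nat.pair j m := Nat.left_le_pair j m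
  generalize Nat.pair j m = k at hk hjk
  have hsk := hs k j hjk
  rw [hk] at hsk
  obtain ⟨β, hβ, hβ'⟩ := killer_spec Γ a (fun i => T k j (en m i))
    ⟨ι (k+1), h1 _, fun i => by
      have := h2 j (k+1) (by omega) (en m i)
      rw [hsk, hc] at this
      exact this⟩ (e ∘ ι k) (endo_comp he (h1 k))
  refine ⟨β, hβ, fun i => ?_⟩
  have := hβ' i
  simpa only [Function.comp, h2 j k hjk, hc] using this

/-- Finite partial maps that extend to an endomorphism. -/
def Good (Γ : RelStruct σ ar D) (L : Set (D × D)) : Prop :=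
  L.Finite ∧ ∃ u, IsEndomorphism Γ u ∧ ∀ p ∈ L, u p.1 = p.2

theorem good_symm (Γ : RelStruct σ ar D) (hcat : IsOmegaCategorical Γ)
    (hcore : IsModelCompleteCore Γ) {L : Set (D × D)} (h : Good Γ L) :
    ∃ v, IsEndomorphism Γ v ∧ ∀ p ∈ L, v p.2 = p.1 := by
  obtain ⟨hf, u, hu, h⟩ := h
  obtain ⟨n, f, hfr⟩ := hf.fin_param
  obtain ⟨β, hβ, hβ'⟩ := return_endo Γ hcat hcore (fun i => (f i).1) u hu
  refine ⟨β, hβ, fun p hp => ?_⟩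
  have hp' := hp
  rw [← hfr.2] at hp
  obtain ⟨i, rfl⟩ := hp
  rw [← h _ hp', hβ']

theorem exists_auto (Γ : RelStruct σ ar D) (hcat : IsOmegaCategorical Γ)
    (hcore : IsModelCompleteCore Γ) {n : ℕ} (a : Fin n → D) (e : D → D)
    (he : IsEndomorphism Γ e) : ∃ α : D ≃ D, IsEndomorphism Γ α ∧ IsEndomorphism Γ α.symm ∧
      ∀ i, α (e (a i)) = a i := by
  have hD : Countable D := hcat.1
  have := Encodable.ofCountable D
  let P := {L : Set (D × D) // Good Γ L}
  let C : D ⊕ D → Order.Cofinal P := fun s => match s with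
    | .inl x => ⟨{L | ∃ y, (x, y) ∈ L.1}, by
        rintro ⟨L, hf, u, hu, h⟩
        refine ⟨⟨insert (x, u x) L, hf.insert _, u, hu, ?_⟩, ⟨u x, Set.mem_insert _ _⟩,
          Set.subset_insert _ _⟩
        rintro p (rfl | hp)
        · rfl
        · exact h p hp⟩
    | .inr y => ⟨{L | ∃ x, (x, y) ∈ L.1}, by
        rintro ⟨L, hL⟩
        obtain ⟨v, hv, hv'⟩ := good_symm Γ hcat hcore hL
        obtain ⟨w, hw, hw'⟩ := return_endo Γ hcat hcore (fun i => a i) e he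
        have hg : Good Γ (Prod.swap '' (insert (v y, y) L)) := by
          refine ⟨(hL.1.insert _).image _, v, hv, ?_⟩
          rintro _ ⟨p, (rfl | hp), rfl⟩
          · rfl
          · exact hv' p hp
        obtain ⟨u, hu, hu'⟩ := good_symm Γ hcat hcore hg
        refine ⟨⟨insert (v y, y) L, hL.1.insert _, u, hu, ?_⟩, ⟨v y, Set.mem_insert _ _⟩,
          Set.subset_insert _ _⟩
        intro p hp
        exact hu' p.swap ⟨p, hp, rfl⟩⟩
  obtain ⟨β, hβ, hβ'⟩ := return_endo Γ hcat hcore a e he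
  let L0 : P := ⟨Set.range fun i => (e (a i), a i), Set.finite_range _, β, hβ, by
    rintro _ ⟨i, rfl⟩; exact hβ' i⟩
  let I := Order.idealOfCofinals L0 C
  have hI0 : L0 ∈ I := Order.mem_idealOfCofinals L0 C
  have hfw : ∀ x, ∃ y, ∃ L ∈ I, (x, y) ∈ L.1 := by
    intro x
    obtain ⟨L, ⟨y, hy⟩, hL⟩ := Order.cofinal_meets_idealOfCofinals L0 C (.inl x)
    exact ⟨y, L, hL, hy⟩
  have hbw : ∀ y, ∃ x, ∃ L ∈ I, (x, y) ∈ L.1 := by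
    intro x
    obtain ⟨L, ⟨y, hy⟩, hL⟩ := Order.cofinal_meets_idealOfCofinals L0 C (.inr x)
    exact ⟨y, L, hL, hy⟩
  have hcol : ∀ {m : ℕ} (p : Fin m → D × D), (∀ i, ∃ L ∈ I, p i ∈ L.1) →
      ∃ L ∈ I, ∀ i, p i ∈ L.1 := by
    intro m
    induction m with
    | zero => intro p _; exact ⟨L0, hI0, fun i => i.elim0⟩
    | succ m ih =>
      intro p hp
      obtain ⟨L1, h1, h1'⟩ := ih (fun i => p i.succ) (fun i => hp _)
      obtain ⟨L2, h2, h2'⟩ := hp 0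
      obtain ⟨L, hL, h3, h4⟩ := I.directed L1 h1 L2 h2
      exact ⟨L, hL, fun i => Fin.cases (h4 h2') (fun i => h3 (h1' i)) i⟩
  choose g hg using hfw
  choose g' hg' using hbw
  have hfun : ∀ x y y', (∃ L ∈ I, (x, y) ∈ L.1) → (∃ L ∈ I, (x, y') ∈ L.1) → y = y' := by
    intro x y y' h h'
    obtain ⟨L, _, hL⟩ := hcol ![(x, y), (x, y')] (by
      intro i; fin_cases i
      · exact h
      · exact h')
    obtain ⟨u, _, hu⟩ := L.2.2
    have a1 := hu _ (hL 0)
    have a2 := hu _ (hL 1)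
    simp at a1 a2
    rw [← a1, a2]
  have hfun' : ∀ x x' y, (∃ L ∈ I, (x, y) ∈ L.1) → (∃ L ∈ I, (x', y) ∈ L.1) → x = x' := by
    intro x x' y h h'
    obtain ⟨L, _, hL⟩ := hcol ![(x, y), (x', y)] (by
      intro i; fin_cases i
      · exact h
      · exact h')
    obtain ⟨u, _, hu⟩ := good_symm Γ hcat hcore L.2
    have a1 := hu _ (hL 0)
    have a2 := hu _ (hL 1)
    simp at a1 a2
    rw [← a1, a2]
  refine ⟨⟨g, g', fun x => hfun' _ _ _ (hg' _) (hg _), fun y => hfun _ _ _ (hg _) (hg' _)⟩,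
    ?_, ?_, ?_⟩
  · intro s t h
    obtain ⟨L, _, hL⟩ := hcol (fun i => (t i, g (t i))) (fun i => hg _)
    obtain ⟨u, hu, hu'⟩ := L.2.2
    have := hu s t h
    convert this using 2 with i
    exact (hu' _ (hL i)).symm
  · intro s t h
    obtain ⟨L, _, hL⟩ := hcol (fun i => (g' (t i), t i)) (fun i => hg' _)
    obtain ⟨u, hu, hu'⟩ := good_symm Γ hcat hcore L.2
    have := hu s t h
    convert this using 2 with i
    exact (hu' _ (hL i)).symm
  · intro i
    exact hfun _ _ _ (hg _) ⟨L0, hI0, i, rfl⟩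

theorem pol_const {Γ : RelStruct σ ar D} {n : ℕ} (a : Fin n → D) {k : ℕ} (f : (Fin k → D) → D)
    (hf : IsPolymorphism Γ f) (ha : ∀ i, f (fun _ => a i) = a i) :
    IsPolymorphism (Γ.withConstants a) f := by
  rintro (s | i)
  · exact hf s
  · intro ts h
    have h' : ∀ l, ts l (0 : Fin 1) = a i := h
    change f (fun l => ts l (0 : Fin 1)) = a i
    simp only [h', ha]

theorem pol_comp {Γ : RelStruct σ ar D} {k : ℕ} (f : (Fin k → D) → D)
    (hf : IsPolymorphism Γ f) (u : D → D) (hu : IsEndomorphism Γ u) :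
    IsPolymorphism Γ (fun t => u (f t)) :=
  fun s ts h => hu s _ (hf s ts h)

end NoCloneHom

theorem no_clone_hom_to_projections
    (σ : Type) (ar : σ → ℕ) (D : Type) (Γ : RelStruct σ ar D)
    (hcat : IsOmegaCategorical Γ) (hcore : IsModelCompleteCore Γ)
    (hsym : HasSymmetricPolymorphismModEndos Γ)
    (n : ℕ) (a : Fin n → D) :
    IsEmpty (CloneHom (polClone (Γ.withConstants a)) (projClone Bool)) := by
  refine ⟨fun ξ => ?_⟩
  obtain ⟨f, e₁, e₂, hf, h₁, h₂, hs⟩ := hsym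
  obtain ⟨α, hα, hα', hαa⟩ := NoCloneHom.exists_auto Γ hcat hcore a (fun x => f x x)
    (fun s t h => hf s (fun _ => t) (fun _ => h))
  obtain ⟨γ, hγ, hγa⟩ := NoCloneHom.return_endo Γ hcat hcore a (e₁ ∘ α.symm)
    (NoCloneHom.endo_comp h₁ hα')
  have hsa : ∀ i, α.symm (a i) = f (a i) (a i) := fun i => by
    rw [Equiv.symm_apply_eq, hαa]
  have hun : ∀ u : D → D, IsEndomorphism Γ u → IsPolymorphism Γ (fun t : Fin 1 → D => u (t 0)) :=
    fun u hu s ts h => hu s _ (h 0)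
  have G : (fun t => α (binOp f t)) ∈ (polClone (Γ.withConstants a)).ops 2 :=
    NoCloneHom.pol_const a _ (NoCloneHom.pol_comp _ hf α hα) hαa
  have H1 : (fun t : Fin 1 → D => γ (e₁ (α.symm (t 0)))) ∈
      (polClone (Γ.withConstants a)).ops 1 :=
    NoCloneHom.pol_const a _ (hun _ (NoCloneHom.endo_comp hγ (NoCloneHom.endo_comp h₁ hα'))) hγa
  have H2 : (fun t : Fin 1 → D => γ (e₂ (α.symm (t 0)))) ∈
      (polClone (Γ.withConstants a)).ops 1 :=
    NoCloneHom.pol_const a _ (hun _ (NoCloneHom.endo_comp hγ (NoCloneHom.endo_comp h₂ hα')))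
      (fun i => by
        have := hγa i
        simp only [Function.comp, hsa] at this ⊢
        rw [← hs, this])
  let G' : {f // f ∈ (polClone (Γ.withConstants a)).ops 2} := ⟨_, G⟩
  let sw : Fin 2 → {f // f ∈ (polClone (Γ.withConstants a)).ops 2} :=
    fun i => ⟨fun t => t (1 - i), (polClone (Γ.withConstants a)).proj_mem 2 (1 - i)⟩
  let Gs : {f // f ∈ (polClone (Γ.withConstants a)).ops 2} :=
    ⟨fun t => G'.1 (fun i => (sw i).1 t), (polClone (Γ.withConstants a)).comp_mem G'.1
      (fun i => (sw i).1) G'.2 (fun i => (sw i).2)⟩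
  have c0 := ξ.map_comp G' sw
  have c1 := ξ.map_comp ⟨_, H1⟩ (fun _ : Fin 1 => G')
  have c2 := ξ.map_comp ⟨_, H2⟩ (fun _ : Fin 1 => Gs)
  have hun2 : ∀ (u : {f // f ∈ (projClone Bool).ops 1}) (t : Fin 1 → Bool), u.1 t = t 0 := by
    rintro ⟨u, i, rfl⟩ t
    rw [Subsingleton.elim i 0]
  have hsw : ∀ i, (ξ.map (sw i)).1 = fun t => t (1 - i) := fun i => ξ.map_proj (1 - i)
  simp only [hun2] at c1 c2
  simp only [hsw] at c0
  have heq : (ξ.map G').1 = (ξ.map Gs).1 := by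
    refine c1.symm.trans (Eq.trans ?_ c2)
    congr 2
    apply Subtype.ext
    funext t
    simp [G', Gs, sw, binOp, hs]
  change (ξ.map Gs).1 = _ at c0
  rw [c0] at heq
  obtain ⟨i, hi⟩ := (ξ.map G').2
  have := congrFun heq ![true, false]
  rw [hi] at this
  fin_cases i <;> simp at this
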